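/- For every subset S of the vertex set of L⁽¹⁾, if ω′ denotes the number of connected components of L⁽¹⁾∖S that contain neither x = w₁ nor y = w₅, then ω′ ≤ 2 and |S| ≥ 2ω′. -/

import Mathlib

open SimpleGraph

/-- Number of connected components of the subgraph induced on the complement of `S`. -/
noncomputable def numComponents {V : Type} (G : SimpleGraph V) (S : Set V) : ℕ :=
  Nat.card (G.induce Sᶜ).ConnectedComponent

/-- `G` is `t`-tough: `|S| ≥ t · ω(G \ S)` for every vertex subset `S`
with `ω(G \ S) > 1`. -/
def IsTough {V : Type} (t : ℝ) (G : SimpleGraph V) : Prop :=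
  ∀ S : Finset V, 1 < numComponents G ↑S →
    t * (numComponents G ↑S : ℝ) ≤ (S.card : ℝ)

/-- The toughness of `G` equals `t`: `t` is the greatest nonnegative real
for which `G` is `t`-tough. -/
def HasToughness {V : Type} (G : SimpleGraph V) (t : ℝ) : Prop :=
  IsGreatest {s : ℝ | 0 ≤ s ∧ IsTough s G} t

/-- A Hamiltonian cycle: a cycle whose support contains every vertex. -/
def IsHamCycle {V : Type} {G : SimpleGraph V} {v : V} (p : G.Walk v v) : Prop :=
  p.IsCycle ∧ ∀ u, u ∈ p.support

/-- A graph is Hamiltonian if it contains a Hamiltonian cycle. -/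
def IsHam {V : Type} (G : SimpleGraph V) : Prop :=
  ∃ (v : V) (p : G.Walk v v), IsHamCycle p

/-- `x` and `y` are connected by a Hamilton path of `G`: a path with endpoints
`x` and `y` containing every vertex of `G`. -/
def HamConnected {V : Type} (G : SimpleGraph V) (x y : V) : Prop :=
  ∃ p : G.Walk x y, p.IsPath ∧ ∀ v, v ∈ p.support

/-- The number of connected components of the subgraph of `G` induced on the
complement of `S` that contain neither `x` nor `y`. -/
noncomputable def numCompAvoiding {V : Type} (G : SimpleGraph V) (S : Set V)
    (x y : V) : ℕ :=
  Nat.card {c : (G.induce Sᶜ).ConnectedComponent //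
    ∀ v : ↥Sᶜ, (G.induce Sᶜ).connectedComponentMk v = c → (v : V) ≠ x ∧ (v : V) ≠ y}

/-- `L⁽¹⁾`: the 8-cycle `w₁w₂…w₈w₁` (here `wᵢ = i - 1`) together with the
edges `w₂w₄, w₄w₆, w₆w₈, w₂w₈`; `x = w₁ = 0`, `y = w₅ = 4`. -/
def L1 : SimpleGraph (Fin 8) := SimpleGraph.fromEdgeSet
  {s(0,1), s(1,2), s(2,3), s(3,4), s(4,5), s(5,6), s(6,7), s(7,0),
   s(1,3), s(3,5), s(5,7), s(1,7)}

/-- The vertex `i` lies outside `S` and in the component `c` of `G \ S`. -/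
def MemComponent {V : Type} {G : SimpleGraph V} {S : Set V}
    (c : (G.induce Sᶜ).ConnectedComponent) (i : V) : Prop :=
  ∃ h : i ∈ Sᶜ, (G.induce Sᶜ).connectedComponentMk ⟨i, h⟩ = c

namespace MemComponent

variable {V : Type} {G : SimpleGraph V} {S : Set V} {c d : (G.induce Sᶜ).ConnectedComponent}
  {i j : V}

theorem notMem (h : MemComponent c i) : i ∉ S := h.1

theorem unique (hc : MemComponent c i) (hd : MemComponent d i) : c = d := by
  obtain ⟨_, rfl⟩ := hc
  exact hd.2

theorem of_adj (h : MemComponent c i) (hij : G.Adj i j) (hj : j ∉ S) : MemComponent c j := by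
  obtain ⟨hi, rfl⟩ := h
  refine ⟨hj, SimpleGraph.ConnectedComponent.sound (Adj.reachable ?_)⟩
  simpa using hij.symm

end MemComponent

theorem exists_memComponent {V : Type} {G : SimpleGraph V} {S : Set V}
    (c : (G.induce Sᶜ).ConnectedComponent) : ∃ i, MemComponent c i := by
  obtain ⟨v, rfl⟩ := c.exists_rep
  exact ⟨v, v.2, rfl⟩

/-- `P` is a nonempty union of components of `L⁽¹⁾ \ S` avoiding `x` and `y`. -/
structure L1AvoidingUnion (S : Finset (Fin 8)) (P : Fin 8 → Prop) : Prop where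
  nonempty : P 1 ∨ P 2 ∨ P 3 ∨ P 5 ∨ P 6 ∨ P 7
  notMem : ∀ i, P i → i ∉ S
  not_zero : ¬ P 0
  not_four : ¬ P 4
  of_adj : ∀ i j, L1.Adj i j → P i → j ∉ S → P j

theorem L1_adj_iff (i j : Fin 8) : L1.Adj i j ↔
    s(i, j) ∈ ({s(0,1), s(1,2), s(2,3), s(3,4), s(4,5), s(5,6), s(6,7), s(7,0),
      s(1,3), s(3,5), s(5,7), s(1,7)} : Finset (Sym2 (Fin 8))) ∧ i ≠ j := by
  simp [L1]

instance : DecidableRel L1.Adj := fun i j => decidable_of_iff' _ (L1_adj_iff i j)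

theorem card_eq_sum_ite (S : Finset (Fin 8)) : S.card =
    (if 0 ∈ S then 1 else 0) + (if 1 ∈ S then 1 else 0) + (if 2 ∈ S then 1 else 0) +
    (if 3 ∈ S then 1 else 0) + (if 4 ∈ S then 1 else 0) + (if 5 ∈ S then 1 else 0) +
    (if 6 ∈ S then 1 else 0) + (if 7 ∈ S then 1 else 0) := by
  rw [← Fin.sum_univ_eight (fun i => if i ∈ S then 1 else 0)]
  simp

namespace L1AvoidingUnion

variable {S : Finset (Fin 8)} {P Q : Fin 8 → Prop}

theorem adj_cases (h : L1AvoidingUnion S P) :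
    (P 1 → 0 ∈ S) ∧ (P 7 → 0 ∈ S) ∧ (P 3 → 4 ∈ S) ∧ (P 5 → 4 ∈ S) ∧
    (P 1 → 3 ∈ S ∨ P 3) ∧ (P 3 → 1 ∈ S ∨ P 1) ∧ (P 3 → 5 ∈ S ∨ P 5) ∧ (P 5 → 3 ∈ S ∨ P 3) ∧
    (P 5 → 7 ∈ S ∨ P 7) ∧ (P 7 → 5 ∈ S ∨ P 5) ∧ (P 7 → 1 ∈ S ∨ P 1) ∧ (P 1 → 7 ∈ S ∨ P 7) ∧
    (P 2 → 1 ∈ S ∨ P 1) ∧ (P 2 → 3 ∈ S ∨ P 3) ∧ (P 6 → 5 ∈ S ∨ P 5) ∧ (P 6 → 7 ∈ S ∨ P 7) ∧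
    (P 1 → 2 ∈ S ∨ P 2) ∧ (P 3 → 2 ∈ S ∨ P 2) ∧ (P 5 → 6 ∈ S ∨ P 6) ∧ (P 7 → 6 ∈ S ∨ P 6) := by
  have key (i j : Fin 8) (hij : L1.Adj i j) (hi : P i) : j ∈ S ∨ P j :=
    or_iff_not_imp_left.2 (h.of_adj i j hij hi)
  have h0 := h.not_zero
  have h4 := h.not_four
  refine ⟨fun hi => (key 1 0 (by decide) hi).resolve_right h0,
    fun hi => (key 7 0 (by decide) hi).resolve_right h0,
    fun hi => (key 3 4 (by decide) hi).resolve_right h4,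
    fun hi => (key 5 4 (by decide) hi).resolve_right h4, ?_⟩
  refine ⟨?_, ?_, ?_, ?_, ?_, ?_, ?_, ?_, ?_, ?_, ?_, ?_, ?_, ?_, ?_, ?_⟩ <;>
    exact key _ _ (by decide)

theorem two_le_card (h : L1AvoidingUnion S P) : 2 ≤ S.card := by
  have := h.adj_cases
  have := h.nonempty
  rw [card_eq_sum_ite]
  grind

theorem triangle_cases (hP : L1AvoidingUnion S P) (hQ : L1AvoidingUnion S Q)
    (hPQ : ∀ i, P i → ¬ Q i) :
    (P 1 ∨ P 2 ∨ P 3) ∧ ¬ (Q 1 ∨ Q 2 ∨ Q 3) ∨ ¬ (P 1 ∨ P 2 ∨ P 3) ∧ (Q 1 ∨ Q 2 ∨ Q 3) := by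
  have hPa := hP.adj_cases
  have hQa := hQ.adj_cases
  have hPn := hP.nonempty
  have hQn := hQ.nonempty
  have hPS := hP.notMem
  have hQS := hQ.notMem
  grind

theorem four_le_card (hP : L1AvoidingUnion S P) (hQ : L1AvoidingUnion S Q)
    (hPQ : ∀ i, P i → ¬ Q i) : 4 ≤ S.card := by
  have hPa := hP.adj_cases
  have hQa := hQ.adj_cases
  have hPn := hP.nonempty
  have hQn := hQ.nonempty
  have hPS := hP.notMem
  have hQS := hQ.notMem
  have ht := hP.triangle_cases hQ hPQ
  rw [card_eq_sum_ite]
  grind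

end L1AvoidingUnion

theorem l1AvoidingUnion_memComponent {S : Finset (Fin 8)}
    {c : (L1.induce (S : Set (Fin 8))ᶜ).ConnectedComponent}
    (hc : ∀ v : ↥(S : Set (Fin 8))ᶜ, (L1.induce (S : Set (Fin 8))ᶜ).connectedComponentMk v = c →
      (v : Fin 8) ≠ 0 ∧ (v : Fin 8) ≠ 4) :
    L1AvoidingUnion S (MemComponent c) := by
  have h0 : ¬ MemComponent c 0 := fun ⟨h, e⟩ => (hc ⟨0, h⟩ e).1 rfl
  have h4 : ¬ MemComponent c 4 := fun ⟨h, e⟩ => (hc ⟨4, h⟩ e).2 rfl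
  refine ⟨?_, fun i hi => by simpa using hi.notMem, h0, h4,
    fun i j hij hi hj => hi.of_adj hij (by simpa using hj)⟩
  obtain ⟨i, hi⟩ := exists_memComponent c
  fin_cases i <;> simp_all

/-- For every vertex subset `S` of `L⁽¹⁾`, the number `ω'` of components of
`L⁽¹⁾ \ S` containing neither `x = w₁` nor `y = w₅` satisfies `ω' ≤ 2` and
`|S| ≥ 2ω'`. -/
theorem L1_components_bound (S : Finset (Fin 8)) :
    numCompAvoiding L1 ↑S 0 4 ≤ 2 ∧
      2 * numCompAvoiding L1 ↑S 0 4 ≤ S.card := by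
  unfold numCompAvoiding
  set T := {c : (L1.induce (S : Set (Fin 8))ᶜ).ConnectedComponent //
    ∀ v : ↥(S : Set (Fin 8))ᶜ, (L1.induce (S : Set (Fin 8))ᶜ).connectedComponentMk v = c →
      (v : Fin 8) ≠ 0 ∧ (v : Fin 8) ≠ 4}
  have hU (c : T) : L1AvoidingUnion S (MemComponent c.1) := l1AvoidingUnion_memComponent c.2
  have hdisj (c d : T) (hcd : c ≠ d) (i : Fin 8) (hi : MemComponent c.1 i) :
      ¬ MemComponent d.1 i := fun hd => hcd (Subtype.ext (hi.unique hd))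
  have hle : Nat.card T ≤ 2 := by
    let f (c : T) : Prop := MemComponent c.1 1 ∨ MemComponent c.1 2 ∨ MemComponent c.1 3
    have hf : Function.Injective f := by
      intro c d hfcd
      by_contra hcd
      have hiff : f c ↔ f d := iff_of_eq hfcd
      rcases (hU c).triangle_cases (hU d) (hdisj c d hcd) with ⟨hc, hd⟩ | ⟨hc, hd⟩
      · exact hd (hiff.1 hc)
      · exact hc (hiff.2 hd)
    simpa using Nat.card_le_card_of_injective f hf
  refine ⟨hle, ?_⟩
  rcases Nat.lt_or_ge 1 (Nat.card T) with h1 | h1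
  · obtain ⟨c, d, hcd⟩ := (Finite.one_lt_card_iff_nontrivial.1 h1).exists_pair_ne
    have := (hU c).four_le_card (hU d) (hdisj c d hcd)
    omega
  · rcases isEmpty_or_nonempty T with hT | ⟨⟨c⟩⟩
    · simp
    · have := (hU c).two_le_card
      omega
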